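/- arXiv:1002.4759 — 3 statements merged into one kernel-verified Lean document; each statement's English description precedes it below -/
import Mathlib

section
/- Let H be a numerical semigroup of genus g ≥ 1 with largest gap l_g, and let H* ⊆ H be a finite subset with exactly n elements. Let π be the smallest element of H \ H* (this set is nonempty since H is infinite and H* is finite). If m ∈ H* and m + l_g < π, then the set (m + H) ∩ H* has exactly n − m elements. -/
/-- Let `H` be a numerical semigroup of genus `g ≥ 1` with largest gap `lg`,
and `H*` a finite subset of `H` with exactly `n` elements. Let `π` be the
smallest element of `H \ H*`. If `m ∈ H*` and `m + lg < π`, then the set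
`(m + H) ∩ H*` has exactly `n − m` elements. -/
theorem stmt9 (H : Set ℕ) (h0 : 0 ∈ H) (hadd : ∀ a ∈ H, ∀ b ∈ H, a + b ∈ H)
    (hfin : (Hᶜ).Finite) (g : ℕ) (hg : (Hᶜ).ncard = g) (hg1 : 1 ≤ g)
    (lg : ℕ) (hlg : lg ∉ H) (hlgmax : ∀ l, l ∉ H → l ≤ lg)
    (Hstar : Finset ℕ) (hsub : ↑Hstar ⊆ H) (n : ℕ) (hn : Hstar.card = n)
    (m : ℕ) (hm : m ∈ Hstar)
    (hmpi : m + lg < sInf {x | x ∈ H ∧ x ∉ Hstar}) :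
    (((fun h => m + h) '' H) ∩ ↑Hstar).ncard = n - m := by
  classical
  set small := {x ∈ Finset.range (lg + 1) | x ∈ H} with hsmall
  set B := {x ∈ Finset.range (lg + 1 + m) | x ∈ H} with hB
  set C := small.image (fun h => m + h) with hC
  have large_mem : ∀ x, lg < x → x ∈ H := fun x hx => by
    by_contra hxH
    exact absurd (hlgmax x hxH) (by omega)
  have mem_of_small : ∀ x ∈ H, x < lg + 1 + m → x ∈ Hstar := fun x hxH hx => by
    by_contra hxs
    have := Nat.sInf_le (show x ∈ {x | x ∈ H ∧ x ∉ Hstar} from ⟨hxH, hxs⟩)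
    omega
  have cardC : C.card = small.card :=
    Finset.card_image_of_injective _ (add_right_injective m)
  have B_eq : B = small ∪ Finset.Ico (lg + 1) (lg + 1 + m) := by
    ext x
    simp only [hB, hsmall, Finset.mem_filter, Finset.mem_range, Finset.mem_union, Finset.mem_Ico]
    have := large_mem x
    grind
  have cardB : B.card = small.card + m := by
    rw [B_eq, Finset.card_union_of_disjoint, Nat.card_Ico]
    · omega
    · rw [Finset.disjoint_left]
      intro x hx hx'
      simp only [hsmall, Finset.mem_filter, Finset.mem_range, Finset.mem_Ico] at hx hx'
      omega
  have C_sub : C ⊆ B := by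
    intro x hx
    simp only [hC, hB, hsmall, Finset.mem_image, Finset.mem_filter, Finset.mem_range] at hx ⊢
    obtain ⟨y, ⟨hy, hyH⟩, rfl⟩ := hx
    exact ⟨by omega, hadd m (hsub hm) y hyH⟩
  have diff_sub : B \ C ⊆ Hstar := by
    intro x hx
    have hxB := (Finset.mem_sdiff.mp hx).1
    simp only [hB, Finset.mem_filter, Finset.mem_range] at hxB
    exact mem_of_small x hxB.2 hxB.1
  have key : ((fun h => m + h) '' H) ∩ ↑Hstar = ↑(Hstar \ (B \ C)) := by
    ext x
    simp only [hC, hB, hsmall, Set.mem_inter_iff, Set.mem_image, Finset.mem_coe,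
      Finset.mem_sdiff, Finset.mem_filter, Finset.mem_range, Finset.mem_image]
    constructor
    · rintro ⟨⟨y, hy, rfl⟩, hx⟩
      exact ⟨hx, fun h => h.2 ⟨y, ⟨by omega, hy⟩, rfl⟩⟩
    · rintro ⟨hx, h⟩
      refine ⟨?_, hx⟩
      by_cases hlt : x < lg + 1 + m
      · by_contra hne
        exact h ⟨⟨hlt, hsub hx⟩, fun ⟨y, hy, hyx⟩ => hne ⟨y, hy.2, hyx⟩⟩
      · exact ⟨x - m, large_mem _ (by omega), by omega⟩
  rw [key, Set.ncard_coe_finset, Finset.card_sdiff_of_subset diff_sub,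
    Finset.card_sdiff_of_subset C_sub, cardB, cardC, hn, Nat.add_sub_cancel_left]
end

section
/- Let H be a numerical semigroup of genus g with gaps l_1 < … < l_g, let n be an integer with n > 2g + 2, and define H* = { m ∈ H : m ≤ n + 2g − 1 and n + 2g − 1 − m ∈ H }, which has exactly n elements m_1 < m_2 < … < m_n. For 1 ≤ i ≤ n set Λ*_i = (m_i + H) ∩ H* and L_i = { m_i + l_1, …, m_i + l_g }. Then for every i = 1, …, n, #Λ*_i = n − i + 1 − #(L_i ∩ H*). -/
/-- Let `H` be a numerical semigroup of genus `g` with gaps `l_1 < … < l_g`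
(enumerated by the strictly monotone `l : Fin g → ℕ`), let `n > 2g + 2` and let
`H* = { m ∈ H : m ≤ n+2g−1 and n+2g−1−m ∈ H }` have elements `m_1 < … < m_n`
(enumerated by the strictly monotone `m : Fin n → ℕ`). With
`Λ*_i = (m_i + H) ∩ H*` and `L_i = {m_i + l_1, …, m_i + l_g}`, one has
`#Λ*_i = n − i + 1 − #(L_i ∩ H*)` for all `i = 1, …, n` (the index `i : Fin n`
is zero-based, so the one-based index is `(i : ℕ) + 1`). -/
theorem stmt13 (H : Set ℕ) (h0 : 0 ∈ H) (hadd : ∀ a ∈ H, ∀ b ∈ H, a + b ∈ H)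
    (hfin : (Hᶜ).Finite) (g n : ℕ) (hg : (Hᶜ).ncard = g) (hn : n > 2 * g + 2)
    (l : Fin g → ℕ) (hl : StrictMono l) (hlran : Set.range l = Hᶜ)
    (m : Fin n → ℕ) (hm : StrictMono m)
    (hmran : Set.range m =
      {x : ℕ | x ∈ H ∧ x ≤ n + 2 * g - 1 ∧ (n + 2 * g - 1 - x) ∈ H})
    (i : Fin n) :
    (((fun h => m i + h) '' H) ∩ Set.range m).ncard =
      n - ((i : ℕ) + 1) + 1 -
        (((fun t => m i + t) '' Set.range l) ∩ Set.range m).ncard := by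
  rw [hlran]
  have hdisj : Disjoint (((fun h => m i + h) '' H) ∩ Set.range m)
      (((fun t => m i + t) '' Hᶜ) ∩ Set.range m) :=
    ((Set.disjoint_image_iff (add_right_injective (m i))).2 disjoint_compl_right).mono
      Set.inter_subset_left Set.inter_subset_left
  have hunion : ((fun h => m i + h) '' H) ∩ Set.range m ∪
      ((fun t => m i + t) '' Hᶜ) ∩ Set.range m = m '' Set.Ici i := by
    rw [← Set.union_inter_distrib_right, ← Set.image_union, Set.union_compl_self]
    ext x
    constructor
    · rintro ⟨⟨t, -, rfl⟩, j, hj⟩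
      exact ⟨j, hm.le_iff_le.1 (hj ▸ Nat.le_add_right _ _), hj⟩
    · rintro ⟨j, hj, rfl⟩
      exact ⟨⟨m j - m i, Set.mem_univ _, Nat.add_sub_cancel' (hm.monotone hj)⟩, j, rfl⟩
  have hcard := Set.ncard_union_eq hdisj ((Set.finite_range m).inter_of_right _)
    ((Set.finite_range m).inter_of_right _)
  rw [hunion, Set.ncard_image_of_injective _ hm.injective, ← Finset.coe_Ici,
    Set.ncard_coe_finset, Fin.card_Ici] at hcard
  have hi := i.isLt
  omega
end

section
/- Let H be a numerical semigroup of genus g, let n be an integer with n > 2g + 2, and define H* = { m ∈ H : m ≤ n + 2g − 1 and n + 2g − 1 − m ∈ H }, which has exactly n elements m_1 < m_2 < … < m_n. For 1 ≤ i ≤ n set Λ*_i = (m_i + H) ∩ H*, and for h ∈ H set A[h] = { t ∈ H : t ≤ h and h − t ∈ H }. Then for every r = 1, …, n, #Λ*_r = #A[m_{n−r+1}]. -/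
/-- A strictly monotone enumeration of a set stable under `x ↦ N - x` is compatible with this
reflection. -/
theorem apply_rev_eq_sub_of_reflect_mem_range {n N : ℕ} {m : Fin n → ℕ} (hm : StrictMono m)
    (hle : ∀ i, m i ≤ N) (hrefl : ∀ i, N - m i ∈ Set.range m) (r : Fin n) :
    m r.rev = N - m r := by
  have hmono : StrictMono fun i : Fin n => N - m i.rev := fun i j hij => by
    have h1 := hm (Fin.rev_lt_rev.mpr hij)
    have h2 := hle i.rev
    dsimp only
    omega
  have hrange : Set.range (fun i : Fin n => N - m i.rev) = Set.range m := by
    apply Set.Subset.antisymm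
    · rintro _ ⟨i, rfl⟩
      exact hrefl i.rev
    · rintro _ ⟨i, rfl⟩
      obtain ⟨j, hj⟩ := hrefl i
      refine ⟨j.rev, ?_⟩
      have h1 := hle i
      simp only [Fin.rev_rev]
      omega
  have h := congrFun ((hmono.range_inj hm).mp hrange) r.rev
  simpa using h.symm


/-- Let `H` be a numerical semigroup of genus `g`, let `n > 2g + 2` and let
`H* = { m ∈ H : m ≤ n+2g−1 and n+2g−1−m ∈ H }` have elements `m_1 < … < m_n`
(enumerated by the strictly monotone `m : Fin n → ℕ`, zero-based indices).
With `Λ*_r = (m_r + H) ∩ H*` and `A[h] = { t ∈ H : t ≤ h, h − t ∈ H }`, one has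
`#Λ*_r = #A[m_{n−r+1}]` for all `r = 1, …, n`; for the zero-based index
`r : Fin n` (one-based index `(r : ℕ) + 1`) the one-based index `n − r + 1`
corresponds to the zero-based index `n − 1 − (r : ℕ)`. -/
theorem stmt14 (H : Set ℕ) (h0 : 0 ∈ H) (hadd : ∀ a ∈ H, ∀ b ∈ H, a + b ∈ H)
    (hfin : (Hᶜ).Finite) (g n : ℕ) (hg : (Hᶜ).ncard = g) (hn : n > 2 * g + 2)
    (m : Fin n → ℕ) (hm : StrictMono m)
    (hmran : Set.range m =
      {x : ℕ | x ∈ H ∧ x ≤ n + 2 * g - 1 ∧ (n + 2 * g - 1 - x) ∈ H})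
    (r : Fin n) :
    (((fun h => m r + h) '' H) ∩ Set.range m).ncard =
      {t : ℕ | t ∈ H ∧ t ≤ m ⟨n - 1 - (r : ℕ), by omega⟩ ∧
        (m ⟨n - 1 - (r : ℕ), by omega⟩ - t) ∈ H}.ncard := by
  set N := n + 2 * g - 1 with hN
  have hmem : ∀ i, m i ∈ H ∧ m i ≤ N ∧ N - m i ∈ H := fun i => by
    have h : m i ∈ Set.range m := ⟨i, rfl⟩
    rwa [hmran] at h
  have hrefl : ∀ i, N - m i ∈ Set.range m := fun i => by
    obtain ⟨h1, h2, h3⟩ := hmem i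
    rw [hmran]
    exact ⟨h3, Nat.sub_le _ _, by rwa [Nat.sub_sub_self h2]⟩
  have hidx : (⟨n - 1 - (r : ℕ), by omega⟩ : Fin n) = r.rev :=
    Fin.ext (by simp only [Fin.val_rev]; omega)
  rw [hidx, apply_rev_eq_sub_of_reflect_mem_range hm (fun i => (hmem i).2.1) hrefl r, hmran, eq_comm,
    ← Set.ncard_image_of_injective _ (add_right_injective (m r)), eq_comm]
  obtain ⟨hr, hrN, -⟩ := hmem r
  congr 1
  ext x
  constructor
  · rintro ⟨⟨h, hh, rfl⟩, -, hle, hsub⟩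
    dsimp only at hle hsub
    exact ⟨h, ⟨hh, by omega, by rwa [Nat.sub_sub]⟩, rfl⟩
  · rintro ⟨h, ⟨hh, hle, hsub⟩, rfl⟩
    exact ⟨⟨h, hh, rfl⟩, hadd _ hr _ hh, by dsimp only; omega, by rwa [Nat.sub_sub] at hsub⟩
end
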